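/- arXiv:1603.04411 — 3 statements merged into one kernel-verified Lean document; each statement's English description precedes it below -/
import Mathlib

section
/- Let A and B be abelian categories, let F : A ⥤ B and G : B ⥤ A be exact functors, and let adj : F ⊣ G be an adjunction whose unit 𝟭_A ⟶ F ⋙ G is an isomorphism. Since F is exact it preserves quasi-isomorphisms of complexes and hence induces a functor D(A) ⥤ D(B) between the derived categories; this induced functor is fully faithful. -/
open CategoryTheory CategoryTheory.Limits

universe w₁ w₂ v₁ v₂ u₁ u₂

/-- An adjunction between additive functors extends degreewise to complexes. -/
noncomputable def complexAdj {A : Type u₁} {B : Type u₂} [Category.{v₁} A] [Category.{v₂} B]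
    [Abelian A] [Abelian B] (F : A ⥤ B) (G : B ⥤ A) [F.Additive] [G.Additive] (adj : F ⊣ G) :
    F.mapHomologicalComplex (ComplexShape.up ℤ) ⊣
      G.mapHomologicalComplex (ComplexShape.up ℤ) :=
  Adjunction.mkOfUnitCounit
    { unit :=
        { app := fun K =>
            { f := fun i => adj.unit.app (K.X i)
              comm' := fun i j _ => (adj.unit.naturality (K.d i j)).symm }
          naturality := fun K L f => by
            ext i
            exact adj.unit.naturality (f.f i) }
      counit :=
        { app := fun K =>
            { f := fun i => adj.counit.app (K.X i)
              comm' := fun i j _ => (adj.counit.naturality (K.d i j)).symm }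
          naturality := fun K L f => by
            ext i
            exact adj.counit.naturality (f.f i) }
      left_triangle := by
        ext K i
        simp
        exact adj.left_triangle_components (K.X i)
      right_triangle := by
        ext K i
        simp
        exact adj.right_triangle_components (K.X i) }

/-- Let `F ⊣ G` be an adjunction between exact functors between abelian
categories whose unit is an isomorphism. Then any functor `F'` between the derived
categories induced by `F` (i.e. any `F' : D(A) ⥤ D(B)` equipped with an isomorphism
`Q ⋙ F' ≅ F.mapHomologicalComplex ⋙ Q` expressing that `F'` is obtained from `F` via
the universal property of the localization at the quasi-isomorphisms) is fully
faithful. -/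
theorem statement4 {A : Type u₁} {B : Type u₂} [Category.{v₁} A] [Category.{v₂} B]
    [Abelian A] [Abelian B]
    [HasDerivedCategory.{w₁} A] [HasDerivedCategory.{w₂} B]
    (F : A ⥤ B) (G : B ⥤ A) [F.Additive] [G.Additive]
    [PreservesFiniteLimits F] [PreservesFiniteColimits F]
    [PreservesFiniteLimits G] [PreservesFiniteColimits G]
    (adj : F ⊣ G) (hunit : IsIso adj.unit)
    (F' : DerivedCategory A ⥤ DerivedCategory B)
    (e : DerivedCategory.Q ⋙ F' ≅
      F.mapHomologicalComplex (ComplexShape.up ℤ) ⋙ DerivedCategory.Q) :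
    F'.Full ∧ F'.Faithful := by
  let W₁ := HomologicalComplex.quasiIso A (ComplexShape.up ℤ)
  let W₂ := HomologicalComplex.quasiIso B (ComplexShape.up ℤ)
  let adjC := complexAdj F G adj
  let : CatCommSq (F.mapHomologicalComplex (ComplexShape.up ℤ)) DerivedCategory.Q
    DerivedCategory.Q F' := ⟨e.symm⟩
  let : CatCommSq (G.mapHomologicalComplex (ComplexShape.up ℤ)) DerivedCategory.Q
    DerivedCategory.Q G.mapDerivedCategory := ⟨G.mapDerivedCategoryFactors.symm⟩
  let adjD : F' ⊣ G.mapDerivedCategory :=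
    adjC.localization DerivedCategory.Q W₁ DerivedCategory.Q W₂ F' G.mapDerivedCategory
  have hC : ∀ K, IsIso (adjC.unit.app K) := fun K => by
    have : ∀ i, IsIso ((adjC.unit.app K).f i) := fun i => by
      change IsIso (adj.unit.app (K.X i))
      infer_instance
    exact HomologicalComplex.Hom.isIso_of_components _
  have hQ : ∀ K : CochainComplex A ℤ, IsIso (adjD.unit.app (DerivedCategory.Q.obj K)) := fun K => by
    have := hC K
    rw [Adjunction.localization_unit_app]
    infer_instance
  have hD : ∀ X, IsIso (adjD.unit.app X) := fun X => by
    have := Localization.essSurj (DerivedCategory.Q (C := A)) W₁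
    have h := hQ (DerivedCategory.Q.objPreimage X)
    exact (NatTrans.isIso_app_iff_of_iso adjD.unit
      (DerivedCategory.Q.objObjPreimageIso X)).1 h
  have : IsIso adjD.unit := NatIso.isIso_of_isIso_app _
  have ff := adjD.fullyFaithfulLOfIsIsoUnit
  exact ⟨ff.full, ff.faithful⟩
end

section
/- Let A and B be abelian categories, let F : A ⥤ B and G : B ⥤ A be exact functors, and let adj : F ⊣ G be an adjunction whose counit F ⋙ G ⟶ 𝟭_B is an isomorphism (i.e., the canonical map F(G(Y)) → Y is an isomorphism for every Y in B). Since G is exact it preserves quasi-isomorphisms and induces a functor D(B) ⥤ D(A) between derived categories; this induced functor is fully faithful. In particular, for all objects X, Y of B and all n ≥ 0, G induces a bijection Ext^n_B(X, Y) ≅ Ext^n_A(G X, G Y). -/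
open CategoryTheory CategoryTheory.Limits CategoryTheory.Abelian

universe w w' w₁ w₂ v₁ v₂ u₁ u₂

/-- An adjunction between additive functors extends to cochain complexes. -/
noncomputable def adjMapComplex {A : Type u₁} {B : Type u₂} [Category.{v₁} A] [Category.{v₂} B]
    [Abelian A] [Abelian B] (F : A ⥤ B) (G : B ⥤ A) [F.Additive] [G.Additive] (adj : F ⊣ G) :
    F.mapHomologicalComplex (ComplexShape.up ℤ) ⊣ G.mapHomologicalComplex (ComplexShape.up ℤ) :=
  Adjunction.mkOfUnitCounit
    { unit :=
        { app := fun K =>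
            { f := fun i => adj.unit.app (K.X i)
              comm' := fun i j _ => (adj.unit.naturality (K.d i j)).symm }
          naturality := fun K L f => by
            ext i
            exact adj.unit.naturality (f.f i) }
      counit :=
        { app := fun K =>
            { f := fun i => adj.counit.app (K.X i)
              comm' := fun i j _ => (adj.counit.naturality (K.d i j)).symm }
          naturality := fun K L f => by
            ext i
            exact adj.counit.naturality (f.f i) }
      left_triangle := by
        ext K i
        simp
        exact adj.left_triangle_components (K.X i)
      right_triangle := by
        ext K i
        simp
        exact adj.right_triangle_components (K.X i) }

lemma adjMapComplex_counit_f {A : Type u₁} {B : Type u₂} [Category.{v₁} A] [Category.{v₂} B]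
    [Abelian A] [Abelian B] (F : A ⥤ B) (G : B ⥤ A) [F.Additive] [G.Additive] (adj : F ⊣ G)
    (K : CochainComplex B ℤ) (i : ℤ) :
    ((adjMapComplex F G adj).counit.app K).f i = adj.counit.app (K.X i) := rfl

/-- Let `F ⊣ G` be an adjunction between exact functors between abelian
categories whose counit is an isomorphism. Then any functor `G'` between the derived
categories induced by `G` (i.e. any `G' : D(B) ⥤ D(A)` equipped with an isomorphism
`Q ⋙ G' ≅ G.mapHomologicalComplex ⋙ Q`) is fully faithful. In particular, for all
objects `X Y : B` and all `n : ℕ`, `G` induces a bijection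
`Ext^n_B(X, Y) ≅ Ext^n_A(G X, G Y)` (expressed here by the map obtained from `G'` after
identifying `G'` of the single complexes with the corresponding single complexes). -/
theorem statement5 {A : Type u₁} {B : Type u₂} [Category.{v₁} A] [Category.{v₂} B]
    [Abelian A] [Abelian B]
    [HasDerivedCategory.{w₁} A] [HasDerivedCategory.{w₂} B]
    [HasExt.{w} A] [HasExt.{w'} B]
    (F : A ⥤ B) (G : B ⥤ A) [F.Additive] [G.Additive]
    [PreservesFiniteLimits F] [PreservesFiniteColimits F]
    [PreservesFiniteLimits G] [PreservesFiniteColimits G]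
    (adj : F ⊣ G) (hcounit : IsIso adj.counit)
    (G' : DerivedCategory B ⥤ DerivedCategory A)
    (e : DerivedCategory.Q ⋙ G' ≅
      G.mapHomologicalComplex (ComplexShape.up ℤ) ⋙ DerivedCategory.Q) :
    G'.Full ∧ G'.Faithful ∧
    ∀ (X Y : B) (n : ℕ),
      ∃ (iX : (DerivedCategory.singleFunctor A 0).obj (G.obj X) ≅
          G'.obj ((DerivedCategory.singleFunctor B 0).obj X))
        (iY : G'.obj (((DerivedCategory.singleFunctor B 0).obj Y)⟦(n : ℤ)⟧) ≅
          ((DerivedCategory.singleFunctor A 0).obj (G.obj Y))⟦(n : ℤ)⟧),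
        Function.Bijective (fun α : Ext X Y n =>
          (Ext.homEquiv.symm (iX.hom ≫ G'.map (Ext.homEquiv α) ≫ iY.hom) :
            Ext (G.obj X) (G.obj Y) n)) := by
  have hK : ∀ K : CochainComplex B ℤ, IsIso ((adjMapComplex F G adj).counit.app K) := fun K => by
    have : ∀ i, IsIso (((adjMapComplex F G adj).counit.app K).f i) := fun i => by
      rw [adjMapComplex_counit_f]
      exact inferInstanceAs (IsIso ((asIso adj.counit).hom.app (K.X i)))
    exact HomologicalComplex.Hom.isIso_of_components _
  let WA := HomologicalComplex.quasiIso A (ComplexShape.up ℤ)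
  let WB := HomologicalComplex.quasiIso B (ComplexShape.up ℤ)
  letI : CatCommSq (F.mapHomologicalComplex (ComplexShape.up ℤ)) DerivedCategory.Q
    DerivedCategory.Q F.mapDerivedCategory := ⟨F.mapDerivedCategoryFactors.symm⟩
  letI : CatCommSq (G.mapHomologicalComplex (ComplexShape.up ℤ)) DerivedCategory.Q
    DerivedCategory.Q G' := ⟨e.symm⟩
  let adj' : F.mapDerivedCategory ⊣ G' := (adjMapComplex F G adj).localization
    DerivedCategory.Q WA DerivedCategory.Q WB F.mapDerivedCategory G'
  have hc : ∀ K : CochainComplex B ℤ, IsIso (adj'.counit.app (DerivedCategory.Q.obj K)) :=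
    fun K => by
      have := hK K
      dsimp only [adj']
      rw [Adjunction.localization_counit_app]
      infer_instance
  have hc' : IsIso adj'.counit := by
    have : ∀ Z, IsIso (adj'.counit.app Z) := fun Z => by
      have := Localization.essSurj (DerivedCategory.Q (C := B)) WB
      rw [← NatTrans.isIso_app_iff_of_iso adj'.counit (DerivedCategory.Q.objObjPreimageIso Z)]
      exact hc _
    exact NatIso.isIso_of_isIso_app _
  have hfull : G'.Full := adj'.fullyFaithfulROfIsIsoCounit.full
  have hfaith : G'.Faithful := adj'.fullyFaithfulROfIsIsoCounit.faithful
  refine ⟨hfull, hfaith, fun X Y n => ?_⟩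
  letI : Localization.Lifting DerivedCategory.Q WB
    (G.mapHomologicalComplex (ComplexShape.up ℤ) ⋙ DerivedCategory.Q) G' := ⟨e⟩
  let φ : G' ≅ G.mapDerivedCategory := Localization.liftNatIso DerivedCategory.Q WB
    (G.mapHomologicalComplex (ComplexShape.up ℤ) ⋙ DerivedCategory.Q)
    (G.mapHomologicalComplex (ComplexShape.up ℤ) ⋙ DerivedCategory.Q) G' G.mapDerivedCategory
    (Iso.refl _)
  let iX : (DerivedCategory.singleFunctor A 0).obj (G.obj X) ≅
      G'.obj ((DerivedCategory.singleFunctor B 0).obj X) :=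
    (φ.app _ ≪≫ (G.mapDerivedCategorySingleFunctor 0).app X).symm
  let iY : G'.obj (((DerivedCategory.singleFunctor B 0).obj Y)⟦(n : ℤ)⟧) ≅
      ((DerivedCategory.singleFunctor A 0).obj (G.obj Y))⟦(n : ℤ)⟧ :=
    φ.app _ ≪≫ (G.mapDerivedCategory.commShiftIso (n : ℤ)).app _ ≪≫
      (shiftFunctor _ (n : ℤ)).mapIso ((G.mapDerivedCategorySingleFunctor 0).app Y)
  refine ⟨iX, iY, ?_⟩
  refine Ext.homEquiv.symm.bijective.comp (Function.Bijective.comp (g := fun f => iX.hom ≫ f ≫ iY.hom)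
    (f := fun α : Ext X Y n => G'.map (Ext.homEquiv α)) ?_ ?_)
  · constructor
    · intro f g h
      simpa using h
    · intro f
      exact ⟨iX.inv ≫ f ≫ iY.inv, by simp⟩
  · exact Function.Bijective.comp ⟨G'.map_injective, G'.map_surjective⟩ Ext.homEquiv.bijective
end

section
/- Let A be an abelian category (with Ext groups defined, e.g. via its derived category), let X be an object of A, and let n ≥ 1 and m ≥ 1 be integers. Let 0 → A₀ → B → D¹ → D² → ⋯ → D^m → 0 be an exact sequence in A, and assume that Ext^i_A(X, D^j) = 0 for every 1 ≤ j ≤ m and every integer i ≥ n − j. Then the natural map Ext^n_A(X, A₀) → Ext^n_A(X, B) induced by the monomorphism A₀ → B is injective. Consequently, if A is k-linear for a field k and Ext^n_A(X, B) has k-dimension at most 1, then Ext^n_A(X, A₀) has k-dimension at most 1. -/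
open CategoryTheory CategoryTheory.Limits CategoryTheory.Abelian

universe w v u

lemma aux_shortExact {A : Type u} [Category.{v} A] [Abelian A] {S₁ S₂ S₃ K : A}
    (f : S₁ ⟶ S₂) (g : S₂ ⟶ S₃) (w : f ≫ g = 0) (hex : (ShortComplex.mk f g w).Exact)
    (p : S₁ ⟶ K) (i : K ⟶ S₂) [Epi p] [Mono i] (fac : p ≫ i = f) :
    ∃ w' : i ≫ factorThruImage g = 0, (ShortComplex.mk i (factorThruImage g) w').ShortExact := by
  have w₁ : f ≫ factorThruImage g = 0 := by
    rw [← cancel_mono (Limits.image.ι g)]; simpa using w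
  have w' : i ≫ factorThruImage g = 0 := by
    rw [← cancel_epi p, ← Category.assoc, fac, w₁, comp_zero]
  refine ⟨w', ?_⟩
  let φ : ShortComplex.mk f (factorThruImage g) w₁ ⟶ ShortComplex.mk f g w :=
    { τ₁ := 𝟙 _, τ₂ := 𝟙 _, τ₃ := Limits.image.ι g }
  let ψ : ShortComplex.mk f (factorThruImage g) w₁ ⟶ ShortComplex.mk i (factorThruImage g) w' :=
    { τ₁ := p, τ₂ := 𝟙 _, τ₃ := 𝟙 _, comm₁₂ := by simpa using fac }
  have : Epi φ.τ₁ := inferInstanceAs (Epi (𝟙 _))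
  have : IsIso φ.τ₂ := inferInstanceAs (IsIso (𝟙 _))
  have : Mono φ.τ₃ := inferInstanceAs (Mono (Limits.image.ι g))
  have : Epi ψ.τ₁ := inferInstanceAs (Epi p)
  have : IsIso ψ.τ₂ := inferInstanceAs (IsIso (𝟙 _))
  have : Mono ψ.τ₃ := inferInstanceAs (Mono (𝟙 _))
  have h₁ := (ShortComplex.exact_iff_of_epi_of_isIso_of_mono φ).2 hex
  have h₂ := (ShortComplex.exact_iff_of_epi_of_isIso_of_mono ψ).1 h₁
  exact { exact := h₂, mono_f := ‹Mono i›, epi_g := inferInstanceAs (Epi (factorThruImage g)) }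

lemma aux_inj {A : Type u} [Category.{v} A] [Abelian A] [HasExt.{w} A] (X : A)
    {S : ShortComplex A} (hS : S.ShortExact) (i : ℕ)
    (h : ∀ i', i' + 1 = i → Subsingleton (Ext X S.X₃ i')) (α : Ext X S.X₁ i)
    (hα : α.comp (Ext.mk₀ S.f) (add_zero i) = 0) : α = 0 := by
  cases i with
  | zero =>
    have := hS.mono_f
    apply Ext.postcomp_mk₀_injective_of_mono X S.f
    simpa using hα
  | succ i =>
    obtain ⟨x, rfl⟩ := Ext.covariant_sequence_exact₁ X hS α hα rfl
    have := h i rfl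
    rw [Subsingleton.elim x 0, Ext.zero_comp]

lemma aux_vanish {A : Type u} [Category.{v} A] [Abelian A] [HasExt.{w} A]
    (X : A) (n m : ℕ) (S : ComposableArrows A (m + 2))
    (hex : S.Exact) (hlast : IsZero (S.obj' (m + 2) (le_refl _)))
    (hvanish : ∀ (j : ℕ), 1 ≤ j → ∀ (hj : j ≤ m) (i : ℕ), (n : ℤ) - (j : ℤ) ≤ (i : ℤ) →
      Subsingleton (Ext X (S.obj' (j + 1) (by omega)) i)) (d : ℕ) :
    ∀ (j : ℕ) (_ : 1 ≤ j) (hj : j + d = m + 1) (K : A) (p : S.obj' j (by omega) ⟶ K)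
      (q : K ⟶ S.obj' (j + 1) (by omega)) (_ : Epi p) (_ : Mono q)
      (_ : p ≫ q = S.map' j (j + 1) (by omega) (by omega)) (i : ℕ),
      (n : ℤ) - (j : ℤ) ≤ (i : ℤ) → Subsingleton (Ext X K i) := by
  induction d with
  | zero =>
    intro j _ hj K p q _ _ _ i _
    obtain rfl : j = m + 1 := by omega
    have hK : IsZero K := IsZero.of_mono q hlast
    refine subsingleton_of_forall_eq 0 fun α => ?_
    rw [← Ext.comp_mk₀_id α, hK.eq_of_src (𝟙 K) 0, Ext.mk₀_zero, Ext.comp_zero]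
  | succ d ih =>
    intro j hj1 hj K p q _ _ fac i hi
    obtain ⟨w', hS⟩ := aux_shortExact _ _ _ (hex.exact j (by omega)) p q fac
    refine subsingleton_of_forall_eq 0 fun α => ?_
    refine aux_inj X hS i (fun i' hi' => ?_) α ?_
    · exact ih (j + 1) (by omega) (by omega) _ _ _ inferInstance inferInstance
        (Limits.image.fac _) i' (by push_cast; omega)
    · have := hvanish j hj1 (by omega) i hi
      exact Subsingleton.elim _ _

/-- Given an exact sequence `0 → A₀ → B → D¹ → ⋯ → Dᵐ → 0` in an abelian
category `A` (encoded as a composable chain `S : A₀ → B → D¹ → ⋯ → Dᵐ → 0` which is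
exact, whose first map `A₀ → B` is a monomorphism, and whose last object is zero), if
`Ext^i(X, Dʲ) = 0` for all `1 ≤ j ≤ m` and all integers `i ≥ n - j`, then the map
`Ext^n(X, A₀) → Ext^n(X, B)` induced by the monomorphism `A₀ → B` is injective.
Consequently, for any field `k` and `k`-module structures making this map `k`-linear,
if `Ext^n(X, B)` has `k`-dimension at most `1`, so does `Ext^n(X, A₀)`. -/
theorem statement7 {A : Type u} [Category.{v} A] [Abelian A] [HasExt.{w} A]
    (X : A) (n m : ℕ) (hn : 1 ≤ n) (hm : 1 ≤ m)
    (S : ComposableArrows A (m + 2))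
    (hex : S.Exact) (hmono : Mono (S.map' 0 1 (Nat.zero_le _) (Nat.le_add_left 1 (m + 1)))) (hlast : IsZero (S.obj' (m + 2) (le_refl _)))
    (hvanish : ∀ (j : ℕ), 1 ≤ j → ∀ (hj : j ≤ m) (i : ℕ), (n : ℤ) - (j : ℤ) ≤ (i : ℤ) →
      Subsingleton (Ext X (S.obj' (j + 1) (by omega)) i)) :
    Function.Injective (fun α : Ext X (S.obj' 0 (Nat.zero_le _)) n =>
      α.comp (Ext.mk₀ (S.map' 0 1 (Nat.zero_le _) (Nat.le_add_left 1 (m + 1)))) (add_zero n)) ∧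
    ∀ (k : Type*) [Field k] [Module k (Ext X (S.obj' 0 (Nat.zero_le _)) n)]
      [Module k (Ext X (S.obj' 1 (Nat.le_add_left 1 (m + 1))) n)],
      IsLinearMap k (fun α : Ext X (S.obj' 0 (Nat.zero_le _)) n =>
        α.comp (Ext.mk₀ (S.map' 0 1 (Nat.zero_le _) (Nat.le_add_left 1 (m + 1)))) (add_zero n)) →
      Module.rank k (Ext X (S.obj' 1 (Nat.le_add_left 1 (m + 1))) n) ≤ 1 →
      Module.rank k (Ext X (S.obj' 0 (Nat.zero_le _)) n) ≤ 1 := by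
  have hinj : Function.Injective (fun α : Ext X (S.obj' 0 (Nat.zero_le _)) n =>
      α.comp (Ext.mk₀ (S.map' 0 1 (Nat.zero_le _) (Nat.le_add_left 1 (m + 1))))
        (add_zero n)) := by
    obtain ⟨w', hS⟩ := aux_shortExact _ _ _ (hex.exact 0 (by omega)) (𝟙 _)
      (S.map' 0 1 (Nat.zero_le _) (Nat.le_add_left 1 (m + 1))) (Category.id_comp _)
    intro α β h
    rw [← sub_eq_zero]
    refine aux_inj X hS n (fun i' hi' => ?_) (α - β) ?_
    · exact aux_vanish X n m S hex hlast hvanish m 1 le_rfl (by omega) _ _ _ inferInstance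
        inferInstance (Limits.image.fac _) i' (by push_cast; omega)
    · exact (map_sub ((Ext.mk₀ (S.map' 0 1 (Nat.zero_le _)
        (Nat.le_add_left 1 (m + 1)))).postcomp X (add_zero n)) α β).trans (sub_eq_zero.2 h)
  refine ⟨hinj, ?_⟩
  intro k _ _ _ hlin hrank
  exact (LinearMap.rank_le_of_injective (hlin.mk' _) hinj).trans hrank
end
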